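/- The counter specification — the set of finite sequences over the symbols inc, dec, and read(z) (z ∈ ℤ) such that every occurrence of read(z) satisfies z = (number of preceding inc symbols) − (number of preceding dec symbols) — is anagram-agnostic. -/

import Mathlib

/-- τ1 ∼ τ2 : the two sequences admit exactly the same legal continuations. -/
def SpecEquiv {A : Type} (T : Set (List A)) (τ1 τ2 : List A) : Prop :=
  ∀ τ' : List A, τ1 ++ τ' ∈ T ↔ τ2 ++ τ' ∈ T

/-- A specification is anagram-agnostic if any two of its members that are
permutations of one another (anagrams) are equivalent. -/
def AnagramAgnostic {A : Type} (T : Set (List A)) : Prop :=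
  ∀ τ1 ∈ T, ∀ τ2 ∈ T, τ1.Perm τ2 → SpecEquiv T τ1 τ2

inductive CounterOp : Type
  | inc : CounterOp
  | dec : CounterOp
  | read (z : ℤ) : CounterOp
deriving DecidableEq

/-- The counter specification: every `read z` reports the number of preceding
`inc`s minus the number of preceding `dec`s. -/
def CounterSpec : Set (List CounterOp) :=
  {w | ∀ (p : List CounterOp) (z : ℤ) (s : List CounterOp),
    w = p ++ CounterOp.read z :: s →
      z = (p.count CounterOp.inc : ℤ) - (p.count CounterOp.dec : ℤ)}

theorem CounterSpec.append_mem_of_perm {τ1 τ2 τ' : List CounterOp} (h2 : τ2 ∈ CounterSpec)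
    (hp : τ1.Perm τ2) (h : τ1 ++ τ' ∈ CounterSpec) : τ2 ++ τ' ∈ CounterSpec := by
  intro p z s e
  have key : ∀ a, τ' = a ++ CounterOp.read z :: s → p = τ2 ++ a →
      z = (p.count CounterOp.inc : ℤ) - (p.count CounterOp.dec : ℤ) := by
    rintro a ha rfl
    have := h (τ1 ++ a) z s (by rw [ha, List.append_assoc])
    simpa only [List.count_append, hp.count_eq] using this
  rcases List.append_eq_append_iff.1 e with ⟨a, hpa, ha⟩ | ⟨c, hc, hs⟩
  · exact key a ha hpa
  · cases c with
    | nil => exact key [] (by simpa using hs.symm) (by simpa using hc.symm)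
    | cons x c =>
      obtain ⟨rfl, -⟩ := List.cons.inj hs
      exact h2 p z c hc

theorem stmt6 : AnagramAgnostic CounterSpec := by
  intro τ1 h1 τ2 h2 hp τ'
  exact ⟨CounterSpec.append_mem_of_perm h2 hp, CounterSpec.append_mem_of_perm h1 hp.symm⟩
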